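/- arXiv:1306.5464 — 2 statements merged into one kernel-verified Lean document; each statement's English description precedes it below -/
import Mathlib

section
/- Let b = b_{k+1} b_{k+2} … b_n, with 1 ≤ k < n, be an admissible suffix in A_n, and let x ∈ α_A(b). Then: μ_A(xb) = x if x ≥ μ_A(b); μ_A(xb) = μ_A(b) if b_{k+1} ≤ x < μ_A(b); and μ_A(xb) = μ_A(b) − 1 if x < b_{k+1}. -/
/-- Ascent statistic of the prefix `s 1, …, s k` (sequences are 1-indexed). -/
def ascStat (s : ℕ → ℕ) (k : ℕ) : ℕ :=
  ((Finset.Ico 1 k).filter (fun i => s i < s (i + 1))).card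

/-- Maximum statistic of the prefix `s 1, …, s k`. -/
def maxStat (s : ℕ → ℕ) (k : ℕ) : ℕ :=
  (Finset.Icc 1 k).sup s

/-- Length statistic of the prefix `s 1, …, s k` (its length minus one). -/
def lenStat (_ : ℕ → ℕ) (k : ℕ) : ℕ := k - 1

/-- Last-value statistic of the prefix `s 1, …, s k`. -/
def lvStat (s : ℕ → ℕ) (k : ℕ) : ℕ := s k

/-- Subexcedant sequences of length `n` (positions `1,…,n`). -/
def memSE (n : ℕ) (s : ℕ → ℕ) : Prop :=
  s 1 = 0 ∧ ∀ k, 1 ≤ k → k < n → s (k + 1) ≤ k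

/-- Ascent sequences of length `n`. -/
def memA (n : ℕ) (s : ℕ → ℕ) : Prop :=
  s 1 = 0 ∧ ∀ k, 1 ≤ k → k < n → s (k + 1) ≤ ascStat s k + 1

/-- Restricted growth functions of length `n`. -/
def memR (n : ℕ) (s : ℕ → ℕ) : Prop :=
  s 1 = 0 ∧ ∀ k, 1 ≤ k → k < n → s (k + 1) ≤ maxStat s k + 1

/-- Staircase words of length `n`. -/
def memS (n : ℕ) (s : ℕ → ℕ) : Prop :=
  s 1 = 0 ∧ ∀ k, 1 ≤ k → k < n → s (k + 1) ≤ s k + 1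

/-- The Reflected Gray Code order `≺` on length-`n` sequences:
at the leftmost position `k` where `s` and `t` differ, either the sum of the
first `k-1` entries of `s` is even and `s k < t k`, or it is odd and `s k > t k`. -/
def rgcLt (n : ℕ) (s t : ℕ → ℕ) : Prop :=
  ∃ k, 1 ≤ k ∧ k ≤ n ∧ (∀ i, 1 ≤ i → i < k → s i = t i) ∧ s k ≠ t k ∧
    ((Even (∑ i ∈ Finset.Ico 1 k, s i) ∧ s k < t k) ∨
     (¬ Even (∑ i ∈ Finset.Ico 1 k, s i) ∧ t k < s k))

/-- The Co-Reflected Gray Code order `≺_c` on length-`n` sequences: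
at the rightmost position `k` where `s` and `t` differ, either
`(∑_{i=k+1}^{n} s i) + (n-k)` is even and `s k > t k`, or it is odd and `s k < t k`. -/
def corgcLt (n : ℕ) (s t : ℕ → ℕ) : Prop :=
  ∃ k, 1 ≤ k ∧ k ≤ n ∧ (∀ i, k < i → i ≤ n → s i = t i) ∧ s k ≠ t k ∧
    ((Even ((∑ i ∈ Finset.Ioc k n, s i) + (n - k)) ∧ t k < s k) ∨
     (¬ Even ((∑ i ∈ Finset.Ioc k n, s i) + (n - k)) ∧ s k < t k))

/-- `t` is the successor of `s` in the set `X` with respect to the order `lt`. -/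
def IsSuccessor (X : (ℕ → ℕ) → Prop) (lt : (ℕ → ℕ) → (ℕ → ℕ) → Prop)
    (s t : ℕ → ℕ) : Prop :=
  X s ∧ X t ∧ lt s t ∧ ¬ ∃ u, X u ∧ lt s u ∧ lt u t

/-- `b` (read at positions `k+1,…,n`) is an admissible suffix in `X`. -/
def AdmissibleSuffix (X : (ℕ → ℕ) → Prop) (n k : ℕ) (b : ℕ → ℕ) : Prop :=
  ∃ s, X s ∧ ∀ i, k < i → i ≤ n → s i = b i

/-- `α_X(b)`: the set of values `x` such that `x b_{k+1} … b_n` is an admissible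
suffix in `X` (occupying positions `k,…,n`). -/
def alphaSet (X : (ℕ → ℕ) → Prop) (n k : ℕ) (b : ℕ → ℕ) : Set ℕ :=
  {x | ∃ s, X s ∧ s k = x ∧ ∀ i, k < i → i ≤ n → s i = b i}

/-- `μ_X(b)`: the minimum value of the statistic `st` on the length-`(k+1)` prefix
`s_1 … s_k b_{k+1}` over all sequences `s` in `X` having suffix `b` at positions
`k+1,…,n`. -/
noncomputable def muVal (X : (ℕ → ℕ) → Prop) (st : (ℕ → ℕ) → ℕ → ℕ) (n k : ℕ) (b : ℕ → ℕ) : ℕ :=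
  sInf {v | ∃ s, X s ∧ (∀ i, k < i → i ≤ n → s i = b i) ∧ st s (k + 1) = v}

theorem ascStat_one (s : ℕ → ℕ) : ascStat s 1 = 0 := by
  simp [ascStat]

theorem ascStat_succ (s : ℕ → ℕ) {k : ℕ} (hk : 1 ≤ k) :
    ascStat s (k + 1) = ascStat s k + if s k < s (k + 1) then 1 else 0 := by
  unfold ascStat
  rw [← Finset.insert_Ico_right_eq_Ico_add_one hk, Finset.filter_insert]
  split_ifs with h
  · rw [Finset.card_insert_of_notMem (by simp)]
  · simp

theorem ascStat_congr {s t : ℕ → ℕ} {k : ℕ} (h : ∀ i, 1 ≤ i → i ≤ k → s i = t i) :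
    ascStat s k = ascStat t k := by
  unfold ascStat
  congr 1
  refine Finset.filter_congr fun i hi => ?_
  rw [Finset.mem_Ico] at hi
  rw [h i hi.1 hi.2.le, h (i + 1) (by omega) hi.2]

theorem ascStat_le (s : ℕ → ℕ) (k : ℕ) : ascStat s k ≤ k - 1 := by
  simpa [ascStat] using Finset.card_filter_le (Finset.Ico 1 k) fun i => s i < s (i + 1)

theorem memA.le_ascStat {n : ℕ} {s : ℕ → ℕ} (hs : memA n s) {k : ℕ} (hk : 1 ≤ k)
    (hkn : k ≤ n) : s k ≤ ascStat s k := by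
  induction k, hk using Nat.le_induction with
  | base => simp [hs.1]
  | succ j hj ih =>
    have h := hs.2 j hj (by omega)
    have ih := ih (by omega)
    rw [ascStat_succ s hj]
    split_ifs <;> omega

theorem memA.mono {m n : ℕ} {s : ℕ → ℕ} (hs : memA n s) (hmn : m ≤ n) : memA m s :=
  ⟨hs.1, fun k hk hkm => hs.2 k hk (by omega)⟩

/-- Every ascent number between the last entry and the ascent number of an ascent sequence
is attained by an ascent sequence with the same length and last entry. -/
theorem memA.exists_ascStat_eq {k : ℕ} (hk : 1 ≤ k) {s : ℕ → ℕ} (hs : memA k s) {a : ℕ}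
    (hsa : s k ≤ a) (ha : a ≤ ascStat s k) :
    ∃ t, memA k t ∧ t k = s k ∧ ascStat t k = a := by
  rcases ha.eq_or_lt with rfl | ha
  · exact ⟨s, hs, rfl, rfl⟩
  have hle := ascStat_le s k
  let t : ℕ → ℕ := fun i => if i < k then i + a - (k - 1) else s k
  have ht : ∀ i, i < k → t i = i + a - (k - 1) := fun i hi => if_pos hi
  have htk : t k = s k := if_neg (lt_irrefl k)
  have hasc : ∀ i, 1 ≤ i → i < k → ascStat t i = i + a - (k - 1) := by
    intro i hi
    induction i, hi using Nat.le_induction with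
    | base => intro _; rw [ascStat_one]; omega
    | succ j hj ih =>
      intro hjk
      rw [ascStat_succ t hj, ih (by omega), ht j (by omega), ht (j + 1) hjk]
      split_ifs <;> omega
  refine ⟨t, ⟨?_, fun i hi hik => ?_⟩, htk, ?_⟩
  · rw [ht 1 (by omega)]; omega
  · rw [hasc i hi hik]
    rcases (Nat.succ_le_of_lt hik).eq_or_lt with h | h
    · rw [show i + 1 = k from h, htk]; omega
    · rw [ht (i + 1) h]; omega
  · obtain ⟨j, rfl⟩ : ∃ j, k = j + 1 := ⟨k - 1, by omega⟩
    rw [ascStat_succ t (by omega), hasc j (by omega) (by omega), ht j (by omega), htk,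
      if_neg (by omega)]
    omega

theorem ascStat_le_ascStat_of_eq_suffix {n k : ℕ} {s u : ℕ → ℕ} (hk : 1 ≤ k)
    (hsu : ∀ i, k ≤ i → i ≤ n → u i = s i) (h : ascStat s k ≤ ascStat u k) {j : ℕ}
    (hkj : k ≤ j) (hjn : j ≤ n) : ascStat s j ≤ ascStat u j := by
  induction j, hkj using Nat.le_induction with
  | base => exact h
  | succ j hj ih =>
    rw [ascStat_succ s (by omega), ascStat_succ u (by omega), hsu j hj (by omega),
      hsu (j + 1) (by omega) hjn]
    exact Nat.add_le_add_right (ih (by omega)) _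

/-- An ascent sequence of length `k` may be prepended to the suffix of an ascent sequence `s`
as soon as the resulting ascent numbers are large enough. -/
theorem memA.exists_append {n k : ℕ} (hk : 1 ≤ k) {s t : ℕ → ℕ} (hs : memA n s)
    (ht : memA k t) (hst : s (k + 1) ≤ ascStat t k + 1)
    (hasc : ascStat s (k + 1) ≤ ascStat t k + if t k < s (k + 1) then 1 else 0) :
    ∃ u, memA n u ∧ (∀ i, k < i → u i = s i) ∧ u k = t k ∧ ascStat u k = ascStat t k := by
  let u : ℕ → ℕ := fun i => if i ≤ k then t i else s i
  have hut : ∀ i, i ≤ k → u i = t i := fun i hi => if_pos hi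
  have hus : ∀ i, k < i → u i = s i := fun i hi => if_neg (by omega)
  have hau : ∀ i, i ≤ k → ascStat u i = ascStat t i := fun i hi =>
    ascStat_congr fun j _ hj => hut j (by omega)
  have hsucc : ascStat s (k + 1) ≤ ascStat u (k + 1) := by
    rwa [ascStat_succ u hk, hau k le_rfl, hut k le_rfl, hus (k + 1) (by omega)]
  refine ⟨u, ⟨by rw [hut 1 hk, ht.1], fun i hi hin => ?_⟩, hus, hut k le_rfl, hau k le_rfl⟩
  rcases lt_trichotomy i k with h | rfl | h
  · rw [hut (i + 1) h, hau i h.le]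
    exact ht.2 i hi h
  · rwa [hus (i + 1) (by omega), hau i le_rfl]
  · rw [hus (i + 1) (by omega)]
    have := ascStat_le_ascStat_of_eq_suffix (n := n) (by omega)
      (fun j hj _ => hus j (by omega)) hsucc (Nat.succ_le_of_lt h) hin.le
    have := hs.2 i hi hin
    omega

/-- Recurrence for `μ_A(xb)` for an admissible suffix `b` in `A_n`
and `x ∈ α_A(b)`. -/
theorem mu_A_recurrence
    (n k : ℕ) (hk1 : 1 ≤ k) (hkn : k < n)
    (b : ℕ → ℕ) (hb : AdmissibleSuffix (memA n) n k b)
    (x : ℕ) (hx : x ∈ alphaSet (memA n) n k b) :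
    (muVal (memA n) ascStat n k b ≤ x →
      muVal (memA n) ascStat n (k - 1) (Function.update b k x) = x) ∧
    (b (k + 1) ≤ x → x < muVal (memA n) ascStat n k b →
      muVal (memA n) ascStat n (k - 1) (Function.update b k x) =
        muVal (memA n) ascStat n k b) ∧
    (x < b (k + 1) →
      muVal (memA n) ascStat n (k - 1) (Function.update b k x) =
        muVal (memA n) ascStat n k b - 1) := by
  obtain ⟨s₀, hs₀, rfl, hb₀⟩ := hx
  obtain ⟨s₁, hs₁, hb₁, hm⟩ : muVal (memA n) ascStat n k b ∈
      {v | ∃ s, memA n s ∧ (∀ i, k < i → i ≤ n → s i = b i) ∧ ascStat s (k + 1) = v} := by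
    obtain ⟨s, hs, hsb⟩ := hb
    exact Nat.sInf_mem ⟨_, s, hs, hsb, rfl⟩
  have hmin : ∀ s, memA n s → (∀ i, k < i → i ≤ n → s i = b i) →
      muVal (memA n) ascStat n k b ≤ ascStat s (k + 1) :=
    fun s hs hsb => Nat.sInf_le ⟨s, hs, hsb, rfl⟩
  generalize muVal (memA n) ascStat n k b = m at hm hmin ⊢
  have hbk : s₁ (k + 1) = b (k + 1) := hb₁ _ (by omega) hkn
  have hbm : b (k + 1) ≤ m := by
    rw [← hbk, ← hm]
    exact hs₁.le_ascStat (by omega) hkn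
  have hlower : ∀ s, memA n s → s k = s₀ k → (∀ i, k < i → i ≤ n → s i = b i) →
      s₀ k ≤ ascStat s k ∧ m ≤ ascStat s k + if s₀ k < b (k + 1) then 1 else 0 := by
    intro s hs hsk hsb
    have h := hmin s hs hsb
    rw [ascStat_succ s hk1, hsk, hsb (k + 1) (by omega) hkn] at h
    exact ⟨hsk ▸ hs.le_ascStat hk1 hkn.le, h⟩
  have key : ∀ a, s₀ k ≤ a → a ≤ ascStat s₀ k → b (k + 1) ≤ a + 1 →
      (m ≤ a + if s₀ k < b (k + 1) then 1 else 0) →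
      (∀ s, memA n s → s k = s₀ k → (∀ i, k < i → i ≤ n → s i = b i) → a ≤ ascStat s k) →
      muVal (memA n) ascStat n (k - 1) (Function.update b k (s₀ k)) = a := by
    intro a hxa ha hba hma hleast
    refine IsLeast.csInf_eq ⟨?_, ?_⟩
    · obtain ⟨t, ht, htk, hta⟩ := (hs₀.mono hkn.le).exists_ascStat_eq hk1 hxa ha
      obtain ⟨u, hu, hus, huk, hua⟩ := hs₁.exists_append hk1 ht
        (by rwa [hbk, hta]) (by rwa [hm, hta, htk, hbk])
      refine ⟨u, hu, fun i hi hin => ?_, ?_⟩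
      · rcases eq_or_ne i k with rfl | hik
        · rw [Function.update_self, huk, htk]
        · rw [Function.update_of_ne hik, hus i (by omega), hb₁ i (by omega) hin]
      · rw [Nat.sub_add_cancel hk1, hua, hta]
    · rintro _ ⟨s, hs, hsb, rfl⟩
      rw [Nat.sub_add_cancel hk1]
      refine hleast s hs ?_ fun i hi hin => ?_
      · rw [hsb k (by omega) hkn.le, Function.update_self]
      · rw [hsb i (by omega) hin, Function.update_of_ne (by omega)]
  have h₀ := hlower s₀ hs₀ rfl hb₀
  refine ⟨fun h => ?_, fun h h' => ?_, fun h => ?_⟩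
  · exact key _ le_rfl h₀.1 (by omega) (by omega) fun s hs hsk hsb => (hlower s hs hsk hsb).1
  · have hx : ¬ s₀ k < b (k + 1) := by omega
    simp only [if_neg hx, add_zero] at h₀ hlower key
    exact key _ h'.le h₀.2 (by omega) le_rfl fun s hs hsk hsb => (hlower s hs hsk hsb).2
  · simp only [if_pos h] at h₀ hlower key
    refine key _ (by omega) (by omega) (by omega) (by omega) fun s hs hsk hsb => ?_
    have := (hlower s hs hsk hsb).2
    omega
end

section
/- Let b = b_{k+1} b_{k+2} … b_n, with 1 ≤ k < n, be an admissible suffix in R_n, and let x ∈ α_R(b). Then: μ_R(xb) = x if x ≥ μ_R(b); μ_R(xb) = μ_R(b) if b_{k+1} ≤ x < μ_R(b), or if x < b_{k+1} < μ_R(b); and μ_R(xb) = μ_R(b) − 1 if x < b_{k+1} = μ_R(b). -/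
theorem maxStat_succ (s : ℕ → ℕ) (k : ℕ) : maxStat s (k + 1) = max (maxStat s k) (s (k + 1)) := by
  rw [maxStat, maxStat, ← Finset.insert_Icc_right_eq_Icc_add_one (by omega), Finset.sup_insert,
    max_comm]

theorem maxStat_eq_max_sup_Ioc {s b : ℕ → ℕ} {n k j : ℕ} (hs : ∀ i, k < i → i ≤ n → s i = b i)
    (hkj : k ≤ j) (hjn : j ≤ n) : maxStat s j = max (maxStat s k) ((Finset.Ioc k j).sup b) := by
  induction j, hkj using Nat.le_induction with
  | base => simp
  | succ j hkj ih =>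
    rw [maxStat_succ, ih (by omega), ← Finset.insert_Ioc_right_eq_Ioc_add_one hkj,
      Finset.sup_insert, hs _ (by omega) hjn, max_assoc, max_comm (b _)]

theorem maxStat_lt_of_memR {s : ℕ → ℕ} {n k : ℕ} (hs : memR n s) (hk : 1 ≤ k) (hkn : k ≤ n) :
    maxStat s k < k := by
  induction k, hk using Nat.le_induction with
  | base => simp [maxStat, hs.1]
  | succ k hk ih =>
    have h := hs.2 k hk (by omega)
    have := ih (by omega)
    rw [maxStat_succ]
    omega

/-- A prefix of length `k` with maximum `M` may be followed by `b (k + 1), …, b n`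
in a restricted growth function. -/
def SuffixFits (n k : ℕ) (b : ℕ → ℕ) (M : ℕ) : Prop :=
  ∀ j, k ≤ j → j < n → b (j + 1) ≤ max M ((Finset.Ioc k j).sup b) + 1

theorem SuffixFits.of_memR {n k : ℕ} {b s : ℕ → ℕ} (hk : 1 ≤ k) (hs : memR n s)
    (hsb : ∀ i, k < i → i ≤ n → s i = b i) : SuffixFits n k b (maxStat s k) := by
  intro j hkj hjn
  rw [← maxStat_eq_max_sup_Ioc hsb hkj hjn.le, ← hsb _ (by omega) (by omega)]
  exact hs.2 j (by omega) hjn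

theorem SuffixFits.pred {n k M : ℕ} {b : ℕ → ℕ} (h : SuffixFits n k b (M + 1))
    (hb : b (k + 1) = M + 1) : SuffixFits n k b M := by
  intro j hkj hjn
  rcases hkj.eq_or_lt with rfl | hlt
  · omega
  · have hle : b (k + 1) ≤ (Finset.Ioc k j).sup b := Finset.le_sup (by simp; omega)
    have := h j hkj hjn
    omega

theorem SuffixFits.exists_memR {n m M x : ℕ} {b : ℕ → ℕ} (h : SuffixFits n (m + 1) b M)
    (hx : x = M ∧ M ≤ m ∨ x ≤ M ∧ M < m) :
    ∃ s, memR n s ∧ s (m + 1) = x ∧ (∀ i, m + 1 < i → i ≤ n → s i = b i) ∧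
      maxStat s (m + 1) = M := by
  let s : ℕ → ℕ := fun i => if i ≤ m then min (i - 1) M else if i = m + 1 then x else b i
  have hprefix : ∀ j, j ≤ m → maxStat s j = min (j - 1) M := by
    intro j
    induction j with
    | zero => simp [maxStat]
    | succ j ih =>
      intro hj
      rw [maxStat_succ, ih (by omega)]
      simp only [s, if_pos hj]
      omega
  have hsx : s (m + 1) = x := by simp [s]
  have hsb : ∀ i, m + 1 < i → i ≤ n → s i = b i := fun i hi _ => by
    simp only [s, if_neg (show ¬ i ≤ m by omega), if_neg (show ¬ i = m + 1 by omega)]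
  have hmax : maxStat s (m + 1) = M := by
    rw [maxStat_succ, hprefix m le_rfl, hsx]
    omega
  refine ⟨s, ⟨?_, fun j hj hjn => ?_⟩, hsx, hsb, hmax⟩
  · rcases Nat.eq_zero_or_pos m with rfl | hm
    · rw [zero_add] at hsx
      omega
    · simp only [s, if_pos (show 1 ≤ m from hm)]
      omega
  · rcases lt_trichotomy j m with hjm | rfl | hjm
    · rw [hprefix j hjm.le]
      simp only [s, if_pos (show j + 1 ≤ m from hjm)]
      omega
    · rw [hprefix j le_rfl, hsx]
      omega
    · rw [maxStat_eq_max_sup_Ioc hsb hjm hjn.le, hsb _ (by omega) hjn, hmax]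
      exact h j hjm hjn

theorem muVal_memR_eq_max {n m M : ℕ} {b : ℕ → ℕ} (hn : m + 1 < n)
    (hb : AdmissibleSuffix (memR n) n (m + 1) b) (hM : IsLeast {M | SuffixFits n (m + 1) b M} M) :
    muVal (memR n) maxStat n (m + 1) b = max M (b (m + 2)) := by
  refine IsLeast.csInf_eq ⟨?_, ?_⟩
  · obtain ⟨t, ht, htb⟩ := hb
    have hle := hM.2 (SuffixFits.of_memR (by omega) ht htb)
    have hlt := maxStat_lt_of_memR ht (show 1 ≤ m + 1 by omega) hn.le
    obtain ⟨s, hs, -, hsb, hmax⟩ := hM.1.exists_memR (Or.inl ⟨rfl, by omega⟩)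
    exact ⟨s, hs, hsb, by rw [maxStat_succ, hmax, hsb _ (by omega) hn]⟩
  · rintro _ ⟨s, hs, hsb, rfl⟩
    rw [maxStat_succ, hsb _ (by omega) hn]
    exact max_le_max_right _ (hM.2 (SuffixFits.of_memR (by omega) hs hsb))

theorem muVal_memR_update_eq_max {n m M x : ℕ} {b : ℕ → ℕ} (hn : m + 1 < n)
    (hx : x ∈ alphaSet (memR n) n (m + 1) b) (hM : IsLeast {M | SuffixFits n (m + 1) b M} M) :
    muVal (memR n) maxStat n m (Function.update b (m + 1) x) = max M x := by
  refine IsLeast.csInf_eq ⟨?_, ?_⟩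
  · obtain ⟨t, ht, htx, htb⟩ := hx
    have hfit := SuffixFits.of_memR (by omega) ht htb
    have hle := hM.2 hfit
    have hlt := maxStat_lt_of_memR ht (show 1 ≤ m + 1 by omega) hn.le
    have hsucc := maxStat_succ t m
    have hlt' : 1 ≤ m → maxStat t m < m := fun hm => maxStat_lt_of_memR ht hm (by omega)
    have hzero : m = 0 → maxStat t m = 0 := by rintro rfl; simp [maxStat]
    have hmono : SuffixFits n (m + 1) b (max M x) := fun j hj hjn =>
      (hM.1 j hj hjn).trans (by omega)
    obtain ⟨s, hs, hsx, hsb, hmax⟩ := hmono.exists_memR (x := x) (by omega)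
    refine ⟨s, hs, fun i hi hin => ?_, hmax⟩
    rcases (Nat.succ_le_of_lt hi).eq_or_lt with rfl | hlt
    · simpa using hsx
    · rw [Function.update_of_ne (by omega), hsb i hlt hin]
  · rintro _ ⟨s, hs, hsb, rfl⟩
    have hsx : s (m + 1) = x := by simpa using hsb (m + 1) (by omega) hn.le
    have hsb' : ∀ i, m + 1 < i → i ≤ n → s i = b i := fun i hi hin => by
      rw [hsb i (by omega) hin, Function.update_of_ne (by omega)]
    refine max_le (hM.2 (SuffixFits.of_memR (by omega) hs hsb')) ?_
    rw [maxStat_succ, hsx]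
    exact le_max_right _ _

/-- Recurrence for `μ_R(xb)` for an admissible suffix `b` in `R_n`
and `x ∈ α_R(b)`. -/
theorem mu_R_recurrence
    (n k : ℕ) (hk1 : 1 ≤ k) (hkn : k < n)
    (b : ℕ → ℕ) (hb : AdmissibleSuffix (memR n) n k b)
    (x : ℕ) (hx : x ∈ alphaSet (memR n) n k b) :
    (muVal (memR n) maxStat n k b ≤ x →
      muVal (memR n) maxStat n (k - 1) (Function.update b k x) = x) ∧
    ((b (k + 1) ≤ x ∧ x < muVal (memR n) maxStat n k b) ∨
        (x < b (k + 1) ∧ b (k + 1) < muVal (memR n) maxStat n k b) →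
      muVal (memR n) maxStat n (k - 1) (Function.update b k x) =
        muVal (memR n) maxStat n k b) ∧
    (x < b (k + 1) → b (k + 1) = muVal (memR n) maxStat n k b →
      muVal (memR n) maxStat n (k - 1) (Function.update b k x) =
        muVal (memR n) maxStat n k b - 1) := by
  obtain ⟨m, rfl⟩ : ∃ m, k = m + 1 := ⟨k - 1, by omega⟩
  obtain ⟨M, hM⟩ : ∃ M, IsLeast {M | SuffixFits n (m + 1) b M} M := by
    obtain ⟨t, ht, htb⟩ := hb
    exact ⟨_, isLeast_csInf ⟨_, SuffixFits.of_memR hk1 ht htb⟩⟩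
  have hfirst : b (m + 2) ≤ M + 1 := by simpa using hM.1 (m + 1) le_rfl hkn
  have hne : b (m + 2) = M → M = 0 := by
    intro hbM
    rcases M with _ | M
    · rfl
    · have := hM.2 (SuffixFits.pred hM.1 hbM)
      omega
  rw [Nat.add_sub_cancel, muVal_memR_update_eq_max hkn hx hM, muVal_memR_eq_max hkn hb hM,
    show m + 1 + 1 = m + 2 from rfl]
  omega
end
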